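/- arXiv:2101.09030 — 2 statements merged into one kernel-verified Lean document; each statement's English description precedes it below -/
import Mathlib

section
/- Let G be a finite group with center Z, let p be a prime dividing |G|, and let a, b ∈ G \ Z be such that the images aZ and bZ both have order p² in G/Z and every element of G can be written in the form a^i b^j z with i, j integers and z ∈ Z. Then for 1 ≤ s, t ≤ p² − 1, one has C_G(a^s b) = C_G(a^t b) if and only if s = t. -/
/-- If `a`, `b` and the center generate `G`, then an element commuting with `a` and `b`
is central. -/
theorem mem_center_of_commute_of_commute {G : Type*} [Group G] {a b x : G}
    (hgen : ∀ g : G, ∃ (i j : ℤ) (z : G), z ∈ Subgroup.center G ∧ g = a ^ i * b ^ j * z)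
    (hxa : Commute x a) (hxb : Commute x b) : x ∈ Subgroup.center G := by
  rw [Subgroup.mem_center_iff]
  intro g
  obtain ⟨i, j, z, hz, rfl⟩ := hgen g
  have hxz : Commute x z := Subgroup.mem_center_iff.mp hz x
  exact (((hxa.zpow_right i).mul_right (hxb.zpow_right j)).mul_right hxz).eq.symm

/-- If `a ^ s * b` and `a ^ t * b` commute, then `a ^ (s - t)` commutes with `b`. -/
theorem Commute.zpow_sub_of_pow_mul {G : Type*} [Group G] {a b : G} {s t : ℕ}
    (h : Commute (a ^ s * b) (a ^ t * b)) : Commute (a ^ ((s : ℤ) - t)) b := by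
  have hd : a ^ ((s : ℤ) - t) = a ^ s * b * (a ^ t * b)⁻¹ := by
    rw [zpow_sub, zpow_natCast, zpow_natCast]
    group
  have hb : b = (a ^ t)⁻¹ * (a ^ t * b) := by group
  have hdb : Commute (a ^ ((s : ℤ) - t)) (a ^ t * b) := by
    rw [hd]
    exact h.mul_left (Commute.refl _).inv_left
  rw [hb]
  exact (((Commute.refl a).zpow_left _).pow_right t).inv_right.mul_right hdb


/-- Let `G` be a finite group with center `Z`, `p` a prime dividing `|G|`, and
`a, b ∈ G \ Z` such that `aZ` and `bZ` have order `p²` in `G/Z` and every element of `G`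
can be written as `a^i b^j z` with `i, j` integers and `z ∈ Z`. Then for
`1 ≤ s, t ≤ p² - 1`, one has `C_G(a^s b) = C_G(a^t b)` if and only if `s = t`. -/
theorem centralizer_pow_mul_eq_iff {G : Type*} [Group G] [Fintype G] (p : ℕ)
    (hp : p.Prime) (hpG : p ∣ Fintype.card G) (a b : G)
    (ha : a ∉ Subgroup.center G) (hb : b ∉ Subgroup.center G)
    (haZ : orderOf (a : G ⧸ Subgroup.center G) = p ^ 2)
    (hbZ : orderOf (b : G ⧸ Subgroup.center G) = p ^ 2)
    (hgen : ∀ g : G, ∃ (i j : ℤ) (z : G), z ∈ Subgroup.center G ∧ g = a ^ i * b ^ j * z)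
    (s t : ℕ) (hs1 : 1 ≤ s) (hs2 : s ≤ p ^ 2 - 1) (ht1 : 1 ≤ t) (ht2 : t ≤ p ^ 2 - 1) :
    Subgroup.centralizer {a ^ s * b} = Subgroup.centralizer {a ^ t * b} ↔ s = t := by
  refine ⟨fun h => ?_, fun h => by rw [h]⟩
  have hcomm : Commute (a ^ s * b) (a ^ t * b) := by
    have hmem : a ^ s * b ∈ Subgroup.centralizer {a ^ t * b} := by
      rw [← h, Subgroup.mem_centralizer_singleton_iff]
    exact Subgroup.mem_centralizer_singleton_iff.mp hmem
  have hcenter : a ^ ((s : ℤ) - t) ∈ Subgroup.center G :=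
    mem_center_of_commute_of_commute hgen ((Commute.refl a).zpow_left _)
      hcomm.zpow_sub_of_pow_mul
  have hdvd : ((p ^ 2 : ℕ) : ℤ) ∣ (s : ℤ) - t := by
    rw [← haZ, orderOf_dvd_iff_zpow_eq_one, ← QuotientGroup.mk_zpow]
    exact (QuotientGroup.eq_one_iff _).mpr hcenter
  have hpos : 0 < p ^ 2 := pow_pos hp.pos 2
  have hzero := Int.eq_zero_of_abs_lt_dvd hdvd (by rw [abs_lt]; omega)
  omega
end

section
/- Let p be a prime and let G be a finite group with center Z such that G/Z is isomorphic to a semidirect product Z_{p²} ⋊ Z_{p²}, i.e. G/Z is isomorphic either to Z_{p²} × Z_{p²} or to the nonabelian group presented by ⟨x, y | x^{p²} = y^{p²} = 1, y x = x^{p+1} y⟩. Then the number of distinct element centralizers of G equals (p+1)² + 1, i.e. |Cent(G)| = (p+1)² + 1. -/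
/-- Relators of the group `L₂ = ⟨x, y | x^(p²) = y^(p²) = 1, y x = x^(p+1) y⟩`,
where `x` is the generator `0` and `y` is the generator `1`. -/
def L2Rels (p : ℕ) : Set (FreeGroup (Fin 2)) :=
  {FreeGroup.of 0 ^ p ^ 2, FreeGroup.of 1 ^ p ^ 2,
    FreeGroup.of 1 * FreeGroup.of 0 * (FreeGroup.of 0 ^ (p + 1) * FreeGroup.of 1)⁻¹}

/-- The nonabelian group `L₂` presented by
`⟨x, y | x^(p²) = y^(p²) = 1, y x = x^(p+1) y⟩`. -/
def L2 (p : ℕ) : Type := PresentedGroup (L2Rels p)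

instance (p : ℕ) : Group (L2 p) := by unfold L2; infer_instance

section ZModPrimeSq

variable {p : ℕ}

theorem natCast_mul_self_zmod_sq (p : ℕ) : (p : ZMod (p ^ 2)) * p = 0 := by
  rw [← Nat.cast_mul, ← sq, ZMod.natCast_self]

theorem natCast_mul_eq_natCast_mul_iff (hp : p.Prime) (m n : ℕ) :
    (p : ZMod (p ^ 2)) * m = p * n ↔ m ≡ n [MOD p] := by
  rw [← Nat.cast_mul, ← Nat.cast_mul, ZMod.natCast_eq_natCast_iff, sq]
  exact Nat.ModEq.mul_left_cancel_iff' hp.ne_zero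

theorem natCast_zmod_sq_ne_zero (hp : p.Prime) : (p : ZMod (p ^ 2)) ≠ 0 := by
  intro h
  have := (natCast_mul_eq_natCast_mul_iff hp 1 0).1 (by simpa using h)
  exact hp.one_lt.ne' (Nat.dvd_one.1 ((Nat.modEq_zero_iff_dvd).1 this))

theorem natCast_mul_ne_one_zmod_sq (hp : p.Prime) (s : ZMod (p ^ 2)) :
    (p : ZMod (p ^ 2)) * s ≠ 1 := by
  intro h
  apply natCast_zmod_sq_ne_zero hp
  calc (p : ZMod (p ^ 2)) = p * (p * s) := by rw [h, mul_one]
    _ = 0 := by rw [← mul_assoc, natCast_mul_self_zmod_sq, zero_mul]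

theorem isUnit_or_eq_natCast_mul (hp : p.Prime) (x : ZMod (p ^ 2)) :
    IsUnit x ∨ ∃ s, x = p * s := by
  have : NeZero (p ^ 2) := ⟨pow_ne_zero 2 hp.ne_zero⟩
  obtain ⟨n, rfl⟩ : ∃ n : ℕ, (n : ZMod (p ^ 2)) = x := ⟨x.val, ZMod.natCast_zmod_val x⟩
  by_cases h : p ∣ n
  · obtain ⟨s, rfl⟩ := h
    exact Or.inr ⟨s, by push_cast; rfl⟩
  · left
    rw [ZMod.isUnit_iff_coprime]
    exact (Nat.Coprime.pow_left 2 ((Nat.Prime.coprime_iff_not_dvd hp).2 h)).symm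

theorem exists_fin_natCast_mul_eq (hp : p.Prime) (s : ZMod (p ^ 2)) :
    ∃ n : Fin p, (p : ZMod (p ^ 2)) * s = (p : ZMod (p ^ 2)) * ((n : ℕ) : ZMod (p ^ 2)) := by
  have : NeZero (p ^ 2) := ⟨pow_ne_zero 2 hp.ne_zero⟩
  refine ⟨⟨s.val % p, Nat.mod_lt _ hp.pos⟩, ?_⟩
  conv_lhs => rw [← ZMod.natCast_zmod_val s]
  exact (natCast_mul_eq_natCast_mul_iff hp _ _).2 (Nat.mod_modEq _ _).symm

theorem fin_eq_of_natCast_mul_eq (hp : p.Prime) {m n : Fin p}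
    (h : (p : ZMod (p ^ 2)) * (m : ℕ) = p * (n : ℕ)) : m = n :=
  Fin.ext (((natCast_mul_eq_natCast_mul_iff hp _ _).1 h).eq_of_lt_of_lt m.2 n.2)

/-- The annihilator of a vector for the determinant form on `R × R`. -/
def detPerp {R : Type*} [CommRing R] (v : R × R) : Set (R × R) :=
  {w | v.1 * w.2 = v.2 * w.1}

theorem mem_detPerp {R : Type*} [CommRing R] {v w : R × R} :
    w ∈ detPerp v ↔ v.1 * w.2 = v.2 * w.1 := Iff.rfl

theorem detPerp_smul {R : Type*} [CommRing R] {c : R} (hc : IsUnit c) (x y : R) :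
    detPerp (c * x, c * y) = detPerp (x, y) := by
  ext w
  simp only [mem_detPerp, mul_assoc]
  exact hc.mul_right_inj

/-- Representatives of the vectors over `ZMod (p ^ 2)` up to unit multiples. -/
def vectorRep (p : ℕ) :
    Unit ⊕ ZMod (p ^ 2) ⊕ Fin p ⊕ Fin p ⊕ Unit → ZMod (p ^ 2) × ZMod (p ^ 2)
  | .inl _ => (0, 0)
  | .inr (.inl t) => (1, t)
  | .inr (.inr (.inl s)) => (p * (s : ℕ), 1)
  | .inr (.inr (.inr (.inl t))) => (p, p * (t : ℕ))
  | .inr (.inr (.inr (.inr _))) => (0, p)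

theorem detPerp_vectorRep_injective (hp : p.Prime) :
    Function.Injective fun r => detPerp (vectorRep p r) := by
  intro r r' h
  have key (w : ZMod (p ^ 2) × ZMod (p ^ 2)) :
      (vectorRep p r).1 * w.2 = (vectorRep p r).2 * w.1 ↔
        (vectorRep p r').1 * w.2 = (vectorRep p r').2 * w.1 := Set.ext_iff.1 h w
  have hp0 := natCast_zmod_sq_ne_zero hp
  have hpp := natCast_mul_self_zmod_sq p
  have hp1 := natCast_mul_ne_one_zmod_sq hp
  have h10 : (1 : ZMod (p ^ 2)) ≠ 0 := fun h => hp1 0 (by simp [h])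
  rcases r with _ | t | s | t | _ <;> rcases r' with _ | t' | s' | t' | _ <;>
    simp only [vectorRep] at key
  all_goals
    have k1 := key (0, 1)
    have k2 := key (1, 0)
    have k3 := key (0, p)
    have k4 := key (p, 0)
  all_goals try simp_all
  · simpa using key 1
  · exact hp1 _ (by rw [← mul_assoc]; exact (key 1 t).1 (mul_one t).symm)
  · exact hp1 _ (by rw [← mul_assoc]; exact (key 1 t').2 (mul_one t').symm)
  · exact fin_eq_of_natCast_mul_eq hp (by simpa using ((key _ 1).1 rfl).symm)
  · exact hp0 (k4.2 (by linear_combination -(t' : ℕ) * hpp)).symm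
  · exact hp0 (k4.1 (by linear_combination -(t : ℕ) * hpp)).symm
  · exact fin_eq_of_natCast_mul_eq hp (by simpa using (key 1 (t : ℕ)).1 (mul_one _).symm)

theorem exists_detPerp_vectorRep_eq (hp : p.Prime) (v : ZMod (p ^ 2) × ZMod (p ^ 2)) :
    ∃ r, detPerp (vectorRep p r) = detPerp v := by
  obtain ⟨x, y⟩ := v
  rcases isUnit_or_eq_natCast_mul hp x with hx | ⟨s, rfl⟩
  · obtain ⟨c, rfl⟩ := hx
    refine ⟨.inr (.inl (c⁻¹ * y)), ?_⟩
    rw [vectorRep, ← detPerp_smul c.isUnit]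
    simp
  rcases isUnit_or_eq_natCast_mul hp y with hy | ⟨t, rfl⟩
  · obtain ⟨c, rfl⟩ := hy
    obtain ⟨n, hn⟩ := exists_fin_natCast_mul_eq hp (c⁻¹ * s)
    refine ⟨.inr (.inr (.inl n)), ?_⟩
    rw [vectorRep, ← hn, ← detPerp_smul c.isUnit, mul_left_comm]
    simp
  rcases isUnit_or_eq_natCast_mul hp s with hs | ⟨s, rfl⟩
  · obtain ⟨c, rfl⟩ := hs
    obtain ⟨n, hn⟩ := exists_fin_natCast_mul_eq hp (c⁻¹ * t)
    refine ⟨.inr (.inr (.inr (.inl n))), ?_⟩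
    rw [vectorRep, ← hn, ← detPerp_smul c.isUnit, mul_left_comm (c : ZMod (p ^ 2)),
      c.mul_inv_cancel_left, mul_comm (p : ZMod (p ^ 2)) c]
  rw [← mul_assoc, natCast_mul_self_zmod_sq, zero_mul]
  rcases isUnit_or_eq_natCast_mul hp t with ht | ⟨t, rfl⟩
  · refine ⟨.inr (.inr (.inr (.inr ()))), ?_⟩
    rw [vectorRep, ← detPerp_smul ht, mul_zero, mul_comm]
  · rw [← mul_assoc, natCast_mul_self_zmod_sq, zero_mul]
    exact ⟨.inl (), rfl⟩

end ZModPrimeSq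

/-- If the elements of `G` are coordinatized by vectors over `ZMod (p ^ 2)` so that commuting is
detected by the determinant form, then `G` has `(p + 1) ^ 2 + 1` element centralizers. -/
theorem ncard_range_centralizer_of_det {G : Type*} [Group G] {p : ℕ} (hp : p.Prime)
    (T : G → ZMod (p ^ 2) × ZMod (p ^ 2) → Prop) (hG : ∀ x, ∃ v, T x v) (hV : ∀ v, ∃ x, T x v)
    (hT : ∀ {x y v w}, T x v → T y w → (x * y = y * x ↔ v.1 * w.2 = v.2 * w.1)) :
    (Set.range fun x : G => Subgroup.centralizer {x}).ncard = (p + 1) ^ 2 + 1 := by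
  have : NeZero (p ^ 2) := ⟨pow_ne_zero 2 hp.ne_zero⟩
  have hmem {x y : G} {v w} (hx : T x v) (hy : T y w) :
      y ∈ Subgroup.centralizer {x} ↔ w ∈ detPerp v := by
    rw [Subgroup.mem_centralizer_singleton_iff, eq_comm, hT hx hy, mem_detPerp]
  have hC {x x' : G} {v v'} (hx : T x v) (hx' : T x' v') :
      Subgroup.centralizer {x} = Subgroup.centralizer {x'} ↔ detPerp v = detPerp v' := by
    constructor
    · intro h
      ext w
      obtain ⟨y, hy⟩ := hV w
      rw [← hmem hx hy, h, hmem hx' hy]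
    · intro h
      ext y
      obtain ⟨w, hy⟩ := hG y
      rw [hmem hx hy, h, hmem hx' hy]
  choose ψ hψ using hV
  have hrange : (Set.range fun x : G => Subgroup.centralizer {x}) =
      Set.range fun r => Subgroup.centralizer {ψ (vectorRep p r)} := by
    ext S
    constructor
    · rintro ⟨x, rfl⟩
      obtain ⟨v, hv⟩ := hG x
      obtain ⟨r, hr⟩ := exists_detPerp_vectorRep_eq hp v
      exact ⟨r, (hC (hψ _) hv).2 hr⟩
    · rintro ⟨r, rfl⟩
      exact ⟨_, rfl⟩
  rw [hrange, ← Nat.card_coe_set_eq, Nat.card_range_of_injective]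
  · simp only [Nat.card_eq_fintype_card, Fintype.card_sum, Fintype.card_unit, ZMod.card,
      Fintype.card_fin]
    ring
  · intro r r' h
    exact detPerp_vectorRep_injective hp ((hC (hψ _) (hψ _)).1 h)

section Metacyclic

variable {G : Type*} [Group G] {a b u : G} {r : ℕ}

theorem pow_mul_eq_geom_sum (hba : b * a = u * a * b) (hbu : b * u = u ^ r * b) (j : ℕ) :
    b ^ j * a = u ^ (∑ i ∈ Finset.range j, r ^ i) * a * b ^ j := by
  induction j with
  | zero => simp
  | succ j ih =>
    have hpow (n : ℕ) : b * u ^ n = u ^ (r * n) * b := by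
      rw [pow_mul]
      exact SemiconjBy.pow_right (show SemiconjBy b u (u ^ r) from hbu) n
    rw [pow_succ', mul_assoc, ih, geom_sum_succ, pow_succ]
    simp only [← mul_assoc]
    rw [hpow]
    simp only [mul_assoc]
    rw [← mul_assoc b a, hba]
    simp only [mul_assoc]

theorem pow_mul_pow_eq_geom_sum (hua : u * a = a * u) (hba : b * a = u * a * b)
    (hbu : b * u = u ^ r * b) (j k : ℕ) :
    b ^ j * a ^ k = u ^ (k * ∑ i ∈ Finset.range j, r ^ i) * a ^ k * b ^ j := by
  have h : SemiconjBy (b ^ j) a (u ^ (∑ i ∈ Finset.range j, r ^ i) * a) :=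
    pow_mul_eq_geom_sum hba hbu j
  have h' := (h.pow_right k).eq
  rwa [(show Commute u a from hua).pow_left _ |>.mul_pow, ← pow_mul, mul_comm _ k] at h'

theorem normal_form_mul (hua : u * a = a * u) (hba : b * a = u * a * b)
    (hbu : b * u = u ^ r * b) (i j k l : ℕ) :
    a ^ i * b ^ j * (a ^ k * b ^ l) =
      u ^ (k * ∑ m ∈ Finset.range j, r ^ m) * (a ^ (i + k) * b ^ (j + l)) := by
  have h := ((show Commute u a from hua).pow_pow (k * ∑ m ∈ Finset.range j, r ^ m) i).eq
  rw [mul_assoc, ← mul_assoc (b ^ j), pow_mul_pow_eq_geom_sum hua hba hbu]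
  simp only [← mul_assoc]
  rw [← h]
  simp only [mul_assoc, pow_add]

end Metacyclic

/-- The centralizer count for a central quotient `H` which is a split metacyclic group of order
`p ^ 4` generated by `x`, `y` of order `p ^ 2`. -/
theorem ncard_range_centralizer_of_metacyclic {G H : Type*} [Group G] [Group H] {p : ℕ}
    (hp : p.Prime) (π : G →* H) (hπ : Function.Surjective π) (hker : π.ker = Subgroup.center G)
    {x y : H} {s : ℕ} (hx : orderOf x = p ^ 2) (hy : orderOf y = p ^ 2)
    (hyx : y * x = x ^ (s + 1) * y) (hgen : ∀ h, ∃ i j : ℕ, h = x ^ i * y ^ j) :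
    (Set.range fun x : G => Subgroup.centralizer {x}).ncard = (p + 1) ^ 2 + 1 := by
  have : NeZero (p ^ 2) := ⟨pow_ne_zero 2 hp.ne_zero⟩
  obtain ⟨a, rfl⟩ := hπ x
  obtain ⟨b, rfl⟩ := hπ y
  have hcenter {g : G} : g ∈ Subgroup.center G ↔ π g = 1 := by rw [← hker, MonoidHom.mem_ker]
  have hG (g : G) : ∃ i j : ℕ, ∃ z ∈ Subgroup.center G, g = a ^ i * b ^ j * z := by
    obtain ⟨i, j, h⟩ := hgen (π g)
    refine ⟨i, j, (a ^ i * b ^ j)⁻¹ * g, ?_, by group⟩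
    rw [hcenter, map_mul, h]
    simp
  have hcent {g : G} (h1 : g * a = a * g) (h2 : g * b = b * g) : g ∈ Subgroup.center G := by
    rw [Subgroup.mem_center_iff]
    intro w
    obtain ⟨i, j, z, hz, rfl⟩ := hG w
    have hzg : Commute g z := Subgroup.mem_center_iff.1 hz g
    exact ((((show Commute g a from h1).pow_right i).mul_right
      ((show Commute g b from h2).pow_right j)).mul_right hzg).eq.symm
  have ha (n : ℕ) : a ^ n ∈ Subgroup.center G ↔ p ^ 2 ∣ n := by
    rw [hcenter, map_pow, ← hx, orderOf_dvd_iff_pow_eq_one]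
  have hb (n : ℕ) : b ^ n ∈ Subgroup.center G ↔ p ^ 2 ∣ n := by
    rw [hcenter, map_pow, ← hy, orderOf_dvd_iff_pow_eq_one]
  obtain ⟨u, hu⟩ : ∃ u, u = b * a * b⁻¹ * a⁻¹ := ⟨_, rfl⟩
  have hba : b * a = u * a * b := by rw [hu]; group
  obtain ⟨z, hz⟩ : ∃ z, z = (a ^ s)⁻¹ * u := ⟨_, rfl⟩
  have huz : u = a ^ s * z := by rw [hz]; group
  have hzc : z ∈ Subgroup.center G := by
    rw [hcenter, hz, hu]
    simp only [map_mul, map_inv, map_pow, hyx]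
    rw [pow_succ]
    group
  have hzcomm (g : G) : Commute g z := Subgroup.mem_center_iff.1 hzc g
  have hua : u * a = a * u := by
    rw [huz]
    exact (((Commute.refl a).pow_left s).mul_left (hzcomm a).symm).eq
  have hbapow (n : ℕ) : b * a ^ n = u ^ n * a ^ n * b := by
    have h := (show SemiconjBy b a (u * a) from hba).pow_right n
    rw [(show Commute u a from hua).mul_pow] at h
    exact h
  have hbu : b * u = u ^ (s + 1) * b := by
    conv_lhs => rw [huz]
    rw [← mul_assoc, hbapow, mul_assoc, (hzcomm b).eq, ← mul_assoc, mul_assoc (u ^ s), ← huz,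
      pow_succ]
  have huord : orderOf u = p ^ 2 := by
    have h (n : ℕ) : u ^ n = 1 ↔ p ^ 2 ∣ n := by
      rw [← ha]
      constructor
      · intro h
        refine hcent ((Commute.refl a).pow_left n) ?_
        rw [hbapow, h, one_mul]
      · intro h
        have := hbapow n
        rw [Subgroup.mem_center_iff.1 h b, mul_assoc] at this
        exact (mul_eq_right.1 this.symm)
    exact Nat.dvd_antisymm (orderOf_dvd_iff_pow_eq_one.2 ((h _).2 dvd_rfl))
      ((h _).1 (pow_orderOf_eq_one u))
  set f : ℕ → ℕ := fun j => ∑ m ∈ Finset.range j, (s + 1) ^ m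
  have hupow (m n : ℕ) : u ^ m = u ^ n ↔ (m : ZMod (p ^ 2)) = n := by
    rw [pow_eq_pow_iff_modEq, huord, ZMod.natCast_eq_natCast_iff]
  have hfinj {j l : ℕ} (hjl : j ≤ l) (h : (f j : ZMod (p ^ 2)) = f l) : p ^ 2 ∣ l - j := by
    rw [← hb]
    refine hcent ?_ ((Commute.refl b).pow_left _)
    have hj := pow_mul_eq_geom_sum hba hbu j
    have hl := pow_mul_eq_geom_sum hba hbu l
    rw [← (hupow _ _).2 h] at hl
    obtain ⟨d, rfl⟩ := Nat.exists_eq_add_of_le hjl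
    rw [Nat.add_sub_cancel_left]
    apply mul_left_cancel (a := b ^ j)
    rw [← mul_assoc, ← pow_add, hl, pow_add, ← mul_assoc, ← hj, mul_assoc]
  have hfsurj : Function.Surjective fun t : ZMod (p ^ 2) => (f t.val : ZMod (p ^ 2)) := by
    apply Finite.surjective_of_injective
    have aux {t t' : ZMod (p ^ 2)} (hle : t.val ≤ t'.val)
        (h : (f t.val : ZMod (p ^ 2)) = f t'.val) : t = t' := by
      have := Nat.eq_zero_of_dvd_of_lt (hfinj hle h)
        (lt_of_le_of_lt (Nat.sub_le _ _) (ZMod.val_lt t'))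
      exact ZMod.val_injective _ (by omega)
    intro t t' h
    rcases le_total t.val t'.val with hle | hle
    · exact aux hle h
    · exact (aux hle h.symm).symm
  refine ncard_range_centralizer_of_det hp
    (fun g v => ∃ i j : ℕ, ∃ z ∈ Subgroup.center G, g = a ^ i * b ^ j * z ∧
      v = ((i : ZMod (p ^ 2)), (f j : ZMod (p ^ 2)))) ?_ ?_ ?_
  · intro g
    obtain ⟨i, j, z, hz, h⟩ := hG g
    exact ⟨_, i, j, z, hz, h, rfl⟩
  · rintro ⟨v, w⟩
    obtain ⟨t, rfl⟩ := hfsurj w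
    exact ⟨_, v.val, t.val, 1, one_mem _, rfl, by simp⟩
  · rintro _ _ _ _ ⟨i, j, z, hz, rfl, rfl⟩ ⟨k, l, z', hz', rfl, rfl⟩
    have hz (g : G) : g * z = z * g := Subgroup.mem_center_iff.1 hz g
    have hz' (g : G) : g * z' = z' * g := Subgroup.mem_center_iff.1 hz' g
    have hl (g h : G) : g * z * (h * z') = g * h * (z * z') := by
      rw [mul_assoc, ← mul_assoc z, ← hz h]
      simp only [mul_assoc]
    have hr (g h : G) : h * z' * (g * z) = h * g * (z * z') := by
      rw [mul_assoc, ← mul_assoc z', ← hz' g, mul_assoc g, ← hz z']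
      simp only [mul_assoc]
    rw [hl, hr, mul_left_inj, normal_form_mul hua hba hbu, normal_form_mul hua hba hbu,
      add_comm k, add_comm l, mul_left_inj, hupow]
    rw [Nat.cast_mul, Nat.cast_mul, mul_comm (k : ZMod (p ^ 2))]
    exact eq_comm

namespace L2

variable {p : ℕ}

/-- The generator `x` of `L2 p`. -/
def x (p : ℕ) : L2 p := PresentedGroup.of (rels := L2Rels p) 0

/-- The generator `y` of `L2 p`. -/
def y (p : ℕ) : L2 p := PresentedGroup.of (rels := L2Rels p) 1

theorem mk_eq_one_of_mem {w : FreeGroup (Fin 2)} (hw : w ∈ L2Rels p) :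
    (PresentedGroup.mk (L2Rels p) w) = 1 :=
  PresentedGroup.one_of_mem hw

theorem x_pow (p : ℕ) : x p ^ p ^ 2 = 1 :=
  mk_eq_one_of_mem (w := FreeGroup.of 0 ^ p ^ 2) (by simp [L2Rels])

theorem y_pow (p : ℕ) : y p ^ p ^ 2 = 1 :=
  mk_eq_one_of_mem (w := FreeGroup.of 1 ^ p ^ 2) (by simp [L2Rels])

theorem y_mul_x (p : ℕ) : y p * x p = x p ^ (p + 1) * y p :=
  mul_inv_eq_one.1 (mk_eq_one_of_mem
    (w := FreeGroup.of 1 * FreeGroup.of 0 * (FreeGroup.of 0 ^ (p + 1) * FreeGroup.of 1)⁻¹)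
    (by simp [L2Rels]))

theorem exists_hom {K : Type*} [Group K] {g h : K} (hg : g ^ p ^ 2 = 1) (hh : h ^ p ^ 2 = 1)
    (hhg : h * g = g ^ (p + 1) * h) : ∃ F : L2 p →* K, F (x p) = g ∧ F (y p) = h := by
  have hrels : ∀ r ∈ L2Rels p, FreeGroup.lift ![g, h] r = 1 := by
    rintro r (rfl | rfl | rfl)
    · simpa using hg
    · simpa using hh
    · simp [hhg]
  refine ⟨PresentedGroup.toGroup hrels, ?_, ?_⟩
  · exact PresentedGroup.toGroup.of hrels
  · exact PresentedGroup.toGroup.of hrels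

theorem orderOf_y (p : ℕ) : orderOf (y p) = p ^ 2 := by
  apply Nat.dvd_antisymm (orderOf_dvd_of_pow_eq_one (y_pow p))
  obtain ⟨F, -, hF⟩ := exists_hom (p := p) (g := (1 : Multiplicative (ZMod (p ^ 2))))
    (h := Multiplicative.ofAdd 1) (one_pow _)
    (by rw [← ofAdd_nsmul, nsmul_one, ZMod.natCast_self, ofAdd_zero]) (by simp)
  have := orderOf_map_dvd F (y p)
  rwa [hF, orderOf_ofAdd_eq_addOrderOf, ZMod.addOrderOf_one] at this

theorem orderOf_x (p : ℕ) : orderOf (x p) = p ^ 2 := by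
  apply Nat.dvd_antisymm (orderOf_dvd_of_pow_eq_one (x_pow p))
  have hpp : (p : ZMod (p ^ 2)) * p = 0 := natCast_mul_self_zmod_sq p
  let c : (ZMod (p ^ 2))ˣ := ⟨1 + p, 1 - p, by linear_combination -hpp, by linear_combination -hpp⟩
  have hc (n : ℕ) : ((c ^ n : (ZMod (p ^ 2))ˣ) : ZMod (p ^ 2)) = 1 + n * p := by
    induction n with
    | zero => simp
    | succ n ih =>
      rw [pow_succ c n, Units.val_mul, ih]
      push_cast
      linear_combination (n : ZMod (p ^ 2)) * hpp
  have hadd (n : ℕ) :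
      Equiv.addRight (1 : ZMod (p ^ 2)) ^ n = Equiv.addRight (n : ZMod (p ^ 2)) := by
    ext t
    simp
  obtain ⟨F, hF, -⟩ := exists_hom (p := p) (g := Equiv.addRight (1 : ZMod (p ^ 2)))
    (h := MulAction.toPermHom (ZMod (p ^ 2))ˣ (ZMod (p ^ 2)) c)
    (by rw [hadd]; ext; simp)
    (by
      have h1 : c ^ p ^ 2 = 1 := by
        ext
        rw [hc, ZMod.natCast_self]
        simp
      rw [← map_pow, h1, map_one])
    (by
      rw [hadd]
      ext t
      simp [Units.smul_def, c]
      ring)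
  have h : (Equiv.addRight (1 : ZMod (p ^ 2))) ^ orderOf (x p) = 1 := by
    rw [← hF, ← map_pow, pow_orderOf_eq_one, map_one]
  rw [hadd] at h
  rw [← ZMod.natCast_eq_zero_iff]
  simpa using Equiv.congr_fun h 0

theorem exists_eq_pow_mul_pow (hp : p.Prime) (g : L2 p) : ∃ i j : ℕ, g = x p ^ i * y p ^ j := by
  have hp2 : p ^ 2 ≠ 0 := pow_ne_zero 2 hp.ne_zero
  have hinv {g : L2 p} (hg : g ^ p ^ 2 = 1) : g⁻¹ = g ^ (p ^ 2 - 1) := by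
    rw [inv_eq_iff_mul_eq_one, mul_pow_sub_one hp2, hg]
  have hyx : SemiconjBy (y p) (x p) (x p ^ (p + 1)) := y_mul_x p
  have hright (i j k l : ℕ) :
      ∃ i' j' : ℕ, x p ^ i * y p ^ j * (x p ^ k * y p ^ l) = x p ^ i' * y p ^ j' := by
    induction j generalizing k l with
    | zero => exact ⟨i + k, l, by rw [pow_zero, mul_one, pow_add, mul_assoc]⟩
    | succ j ih =>
      obtain ⟨i', j', h⟩ := ih ((p + 1) * k) (l + 1)
      refine ⟨i', j', ?_⟩
      rw [← h, pow_succ (y p) j, pow_mul, pow_succ' (y p) l]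
      have := (hyx.pow_right k).eq
      simp only [mul_assoc]
      rw [← mul_assoc (y p) (x p ^ k), this]
      simp only [mul_assoc]
  let K : Subgroup (L2 p) :=
    { carrier := {g | ∃ i j : ℕ, g = x p ^ i * y p ^ j}
      one_mem' := ⟨0, 0, by simp⟩
      mul_mem' := by
        rintro _ _ ⟨i, j, rfl⟩ ⟨k, l, rfl⟩
        exact hright i j k l
      inv_mem' := by
        rintro _ ⟨i, j, rfl⟩
        obtain ⟨i', j', h⟩ := hright 0 ((p ^ 2 - 1) * j) ((p ^ 2 - 1) * i) 0
        refine ⟨i', j', ?_⟩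
        rw [← h, mul_inv_rev, ← inv_pow, ← inv_pow, hinv (x_pow p), hinv (y_pow p), ← pow_mul,
          ← pow_mul, pow_zero, pow_zero, one_mul, mul_one] }
  refine PresentedGroup.generated_by (L2Rels p) K (fun i => ?_) g
  fin_cases i
  · exact ⟨1, 0, by rw [pow_one, pow_zero, mul_one]; rfl⟩
  · exact ⟨0, 1, by rw [pow_one, pow_zero, one_mul]; rfl⟩

end L2

theorem card_cent_eq {G : Type*} [Group G] [Fintype G] (p : ℕ) (hp : p.Prime)
    (hiso : Nonempty ((G ⧸ Subgroup.center G) ≃*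
        (Multiplicative (ZMod (p ^ 2)) × Multiplicative (ZMod (p ^ 2)))) ∨
      Nonempty ((G ⧸ Subgroup.center G) ≃* L2 p)) :
    (Set.range fun x : G => Subgroup.centralizer {x}).ncard = (p + 1) ^ 2 + 1 := by
  have : NeZero (p ^ 2) := ⟨pow_ne_zero 2 hp.ne_zero⟩
  have hcount {H : Type} [Group H] (e : (G ⧸ Subgroup.center G) ≃* H) {x y : H} {s : ℕ}
      (hx : orderOf x = p ^ 2) (hy : orderOf y = p ^ 2) (hyx : y * x = x ^ (s + 1) * y)
      (hgen : ∀ h, ∃ i j : ℕ, h = x ^ i * y ^ j) :=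
    ncard_range_centralizer_of_metacyclic hp
      (e.toMonoidHom.comp (QuotientGroup.mk' (Subgroup.center G)))
      (e.surjective.comp (QuotientGroup.mk'_surjective _))
      (by ext g; simp) hx hy hyx hgen
  rcases hiso with ⟨⟨e⟩⟩ | ⟨⟨e⟩⟩
  · have hpow (t : ZMod (p ^ 2)) : Multiplicative.ofAdd (1 : ZMod (p ^ 2)) ^ t.val =
        Multiplicative.ofAdd t := by
      rw [← ofAdd_nsmul, nsmul_one, ZMod.natCast_zmod_val]
    refine hcount e (x := (Multiplicative.ofAdd 1, 1)) (y := (1, Multiplicative.ofAdd 1)) (s := 0)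
      ?_ ?_ ?_ ?_
    · simp [Prod.orderOf]
    · simp [Prod.orderOf]
    · simp
    · rintro ⟨t, t'⟩
      exact ⟨t.toAdd.val, t'.toAdd.val, by simp [hpow]⟩
  · exact hcount e (L2.orderOf_x p) (L2.orderOf_y p) (L2.y_mul_x p) (L2.exists_eq_pow_mul_pow hp)
end
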